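/- Let 0 < ρ < 1 and 0 < δ < 1 satisfy δ < h⁻¹(1−ρ), where h(x) = −x log₂x − (1−x) log₂(1−x) is the binary entropy function. There exist c > 0 and Δ₀, depending only on ρ and δ, such that for every Δ ≥ Δ₀ the following holds. Let C_A ⊆ F₂^A (|A| = |B| = Δ) be any fixed linear code of minimum distance at least δΔ, and let C_B be the kernel of a uniformly random r×Δ matrix over F₂ with r ≥ Δ(1−ρ). Then with probability at least 1 − 2^{−c·Δ^{3/2}}, every matrix X ∈ F₂^{A×B} of Hamming weight at most (δ/2)·Δ^{3/2}/log₂Δ either (i) is supported in the union of at most δΔ/2 rows and at most δΔ/2 columns, or (ii) does not belong to the dual tensor code C_A ⊗ F₂^B + F₂^A ⊗ C_B. -/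

import Mathlib

noncomputable section

/-- Hamming weight of a binary word. -/
def wt {ι : Type*} (x : ι → ZMod 2) : ℕ := {i | x i ≠ 0}.ncard

/-- Hamming distance from a word to a set of words. -/
def distTo {ι : Type*} (x : ι → ZMod 2) (S : Set (ι → ZMod 2)) : ℕ :=
  sInf {d : ℕ | ∃ c ∈ S, wt (x - c) = d}

/-- Minimum distance of a linear code. -/
def minDist {ι : Type*} (C : Submodule (ZMod 2) (ι → ZMod 2)) : ℕ :=
  sInf {d : ℕ | ∃ c ∈ C, c ≠ 0 ∧ wt c = d}

/-- Dual code with respect to the standard bilinear form. -/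
def dualCode {ι : Type*} [Finite ι] (C : Submodule (ZMod 2) (ι → ZMod 2)) :
    Submodule (ZMod 2) (ι → ZMod 2) :=
  letI := Fintype.ofFinite ι
  { carrier := {x | ∀ c ∈ C, ∑ i, x i * c i = 0}
    add_mem' := by
      intro x y hx hy c hc
      have h : ∑ i, (x + y) i * c i = (∑ i, x i * c i) + ∑ i, y i * c i := by
        simp [add_mul, Finset.sum_add_distrib]
      simp only [Set.mem_setOf_eq] at *
      rw [h, hx c hc, hy c hc, add_zero]
    zero_mem' := by
      simp
    smul_mem' := by
      intro t x hx c hc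
      have h : ∑ i, (t • x) i * c i = t * ∑ i, x i * c i := by
        simp [Finset.mul_sum, mul_assoc]
      simp only [Set.mem_setOf_eq] at *
      rw [h, hx c hc, mul_zero] }

/-- The code of matrices all of whose columns lie in `CA`. -/
def colCode {A : Type*} (B : Type*) (CA : Submodule (ZMod 2) (A → ZMod 2)) :
    Submodule (ZMod 2) (A × B → ZMod 2) where
  carrier := {x | ∀ b : B, (fun a => x (a, b)) ∈ CA}
  add_mem' := by intro x y hx hy b; exact CA.add_mem (hx b) (hy b)
  zero_mem' := by intro b; exact CA.zero_mem
  smul_mem' := by intro t x hx b; exact CA.smul_mem t (hx b)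

/-- The code of matrices all of whose rows lie in `CB`. -/
def rowCode (A : Type*) {B : Type*} (CB : Submodule (ZMod 2) (B → ZMod 2)) :
    Submodule (ZMod 2) (A × B → ZMod 2) where
  carrier := {x | ∀ a : A, (fun b => x (a, b)) ∈ CB}
  add_mem' := by intro x y hx hy a; exact CB.add_mem (hx a) (hy a)
  zero_mem' := by intro a; exact CB.zero_mem
  smul_mem' := by intro t x hx a; exact CB.smul_mem t (hx a)

/-- Tensor code `C_A ⊗ C_B`. -/
def tensorCode {A B : Type*} (CA : Submodule (ZMod 2) (A → ZMod 2))
    (CB : Submodule (ZMod 2) (B → ZMod 2)) : Submodule (ZMod 2) (A × B → ZMod 2) :=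
  colCode B CA ⊓ rowCode A CB

/-- Dual tensor code `C_A ⊗ F₂^B + F₂^A ⊗ C_B`. -/
def dualTensor {A B : Type*} (CA : Submodule (ZMod 2) (A → ZMod 2))
    (CB : Submodule (ZMod 2) (B → ZMod 2)) : Submodule (ZMod 2) (A × B → ZMod 2) :=
  colCode B CA ⊔ rowCode A CB

/-- `w`-robustness of the dual tensor code of `CA` and `CB`. -/
def IsRobust {A B : Type*} (CA : Submodule (ZMod 2) (A → ZMod 2))
    (CB : Submodule (ZMod 2) (B → ZMod 2)) (w : ℝ) : Prop :=
  ∀ c ∈ dualTensor CA CB, (wt c : ℝ) ≤ w →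
    ∃ (A' : Set A) (B' : Set B),
      (A'.ncard : ℝ) ≤ (wt c : ℝ) / (minDist CB : ℝ) ∧
      (B'.ncard : ℝ) ≤ (wt c : ℝ) / (minDist CA : ℝ) ∧
      ∀ a b, a ∉ A' → b ∉ B' → c (a, b) = 0

/-- Punctured code: restrictions of codewords of `C` to the coordinates in `A'`. -/
def punct {A : Type*} (C : Submodule (ZMod 2) (A → ZMod 2)) (A' : Set A) :
    Submodule (ZMod 2) (↥A' → ZMod 2) :=
  C.map (LinearMap.funLeft (ZMod 2) (ZMod 2) ((↑) : ↥A' → A))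

/-- `w`-robustness with `p`-resistance to puncturing. -/
def IsRobustPunct {A B : Type*} [Finite A] [Finite B]
    (CA : Submodule (ZMod 2) (A → ZMod 2)) (CB : Submodule (ZMod 2) (B → ZMod 2))
    (w p : ℝ) : Prop :=
  ∀ (A' : Set A) (B' : Set B) (w' : ℕ), (w' : ℝ) ≤ p →
    A'.ncard + w' = Nat.card A → B'.ncard + w' = Nat.card B →
    IsRobust (punct CA A') (punct CB B') w

section Complex

variable {G : Type*} [Group G] [DecidableEq G]

/-- Total no-conjugacy condition. -/
def TNC (A B : Set G) : Prop := ∀ g : G, ∀ a ∈ A, ∀ b ∈ B, a * g ≠ g * b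

/-- The square associated to `(g, a, b)`. -/
def cpxSq (g a b : G) : Finset (G × Bool) :=
  {(g, false), (a * g, true), (g * b, true), (a * g * b, false)}

/-- The set `Q` of squares of the left-right Cayley complex. -/
def Squares (A B : Set G) : Set (Finset (G × Bool)) :=
  {q | ∃ g : G, ∃ a ∈ A, ∃ b ∈ B, q = cpxSq g a b}

/-- Local view of `x : F₂^Q` at the vertex `(g, 0) ∈ V₀`, as an element of `F₂^{A×B}`. -/
def lview0 (A B : Set G) (x : ↥(Squares A B) → ZMod 2) (g : G) :
    ↥A × ↥B → ZMod 2 :=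
  fun ab => x ⟨cpxSq g (ab.1 : G) (ab.2 : G), ⟨g, (ab.1 : G), ab.1.2, (ab.2 : G), ab.2.2, rfl⟩⟩

/-- Local view of `x : F₂^Q` at the vertex `(g, 1) ∈ V₁`, as an element of `F₂^{A×B}`. -/
def lview1 {A B : Set G} (hA : ∀ a ∈ A, a⁻¹ ∈ A) (x : ↥(Squares A B) → ZMod 2) (g : G) :
    ↥A × ↥B → ZMod 2 :=
  fun ab => x ⟨cpxSq ((ab.1 : G) * g) (ab.1 : G)⁻¹ (ab.2 : G),
    ⟨(ab.1 : G) * g, (ab.1 : G)⁻¹, hA _ ab.1.2, (ab.2 : G), ab.2.2, rfl⟩⟩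

/-- The classical code 𝒞₀ of the quantum Tanner code: all local views at
vertices of `V₀` lie in `C₀^⊥ = (C_A ⊗ C_B)^⊥`. -/
def qC0 [Finite G] (A B : Set G) (CA : Submodule (ZMod 2) (↥A → ZMod 2))
    (CB : Submodule (ZMod 2) (↥B → ZMod 2)) :
    Submodule (ZMod 2) (↥(Squares A B) → ZMod 2) where
  carrier := {x | ∀ g : G, lview0 A B x g ∈ dualCode (tensorCode CA CB)}
  add_mem' := by
    intro x y hx hy g
    exact (dualCode (tensorCode CA CB)).add_mem (hx g) (hy g)
  zero_mem' := by
    intro g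
    exact (dualCode (tensorCode CA CB)).zero_mem
  smul_mem' := by
    intro t x hx g
    exact (dualCode (tensorCode CA CB)).smul_mem t (hx g)

/-- The classical code 𝒞₁ of the quantum Tanner code: all local views at
vertices of `V₁` lie in `C₁^⊥ = (C_A^⊥ ⊗ C_B^⊥)^⊥`. -/
def qC1 [Finite G] {A B : Set G} (hA : ∀ a ∈ A, a⁻¹ ∈ A)
    (CA : Submodule (ZMod 2) (↥A → ZMod 2)) (CB : Submodule (ZMod 2) (↥B → ZMod 2)) :
    Submodule (ZMod 2) (↥(Squares A B) → ZMod 2) where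
  carrier := {x | ∀ g : G, lview1 hA x g ∈ dualCode (tensorCode (dualCode CA) (dualCode CB))}
  add_mem' := by
    intro x y hx hy g
    exact (dualCode (tensorCode (dualCode CA) (dualCode CB))).add_mem (hx g) (hy g)
  zero_mem' := by
    intro g
    exact (dualCode (tensorCode (dualCode CA) (dualCode CB))).zero_mem
  smul_mem' := by
    intro t x hx g
    exact (dualCode (tensorCode (dualCode CA) (dualCode CB))).smul_mem t (hx g)

/-- Adjacency matrix of the left Cayley graph `Cay(G, A)`. -/
def cayAdjL (A : Set G) : Matrix G G ℝ :=
  fun g g' => A.indicator (fun _ => (1 : ℝ)) (g' * g⁻¹)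

/-- Adjacency matrix of the right Cayley graph `Cay(G, B)`. -/
def cayAdjR (B : Set G) : Matrix G G ℝ :=
  fun g g' => B.indicator (fun _ => (1 : ℝ)) (g⁻¹ * g')

end Complex

/-- A `Δ`-regular graph (given by its adjacency matrix) is Ramanujan if every
eigenvalue other than `±Δ` has absolute value at most `2√(Δ-1)`. -/
def IsRamanujan {V : Type*} [Fintype V] (M : Matrix V V ℝ) (Δ : ℝ) : Prop :=
  ∀ μ : ℝ, (∃ x : V → ℝ, x ≠ 0 ∧ M.mulVec x = μ • x) → μ ≠ Δ → μ ≠ -Δ →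
    |μ| ≤ 2 * Real.sqrt (Δ - 1)

/-- Probability of the event `S` under the uniform distribution on a finite type. -/
def unifProb {Ω : Type*} [Fintype Ω] (S : Set Ω) : ℝ :=
  (S.ncard : ℝ) / (Fintype.card Ω : ℝ)

end

open Finset in
/-- The weight of a word is the cardinality of its support as a `Finset`. -/
lemma wt_eq_card {ι : Type*} [Fintype ι] (x : ι → ZMod 2) :
    wt x = #{i | x i ≠ 0} := by
  rw [wt, ← Set.ncard_coe_finset]
  simp

lemma minDist_le_wt {ι : Type*} {C : Submodule (ZMod 2) (ι → ZMod 2)} {c : ι → ZMod 2}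
    (hc : c ∈ C) (h0 : c ≠ 0) : minDist C ≤ wt c :=
  Nat.sInf_le ⟨c, hc, h0, rfl⟩

/-- There are at most `(|ι| + 1) ^ n` binary words of weight at most `n`. -/
lemma ncard_wt_le {ι : Type*} [Fintype ι] (n : ℕ) :
    {x : ι → ZMod 2 | wt x ≤ n}.ncard ≤ (Fintype.card ι + 1) ^ n := by
  classical
  let f : (Fin n → Option ι) → (ι → ZMod 2) := fun g i => if ∃ j, g j = some i then 1 else 0
  have hsub : {x : ι → ZMod 2 | wt x ≤ n} ⊆ Set.range f := by
    intro x hx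
    set F : Finset ι := {i | x i ≠ 0} with hF
    have hlen : F.toList.length ≤ n := by
      rw [Finset.length_toList, hF, ← wt_eq_card]; exact hx
    refine ⟨fun j => F.toList[(j : ℕ)]?, ?_⟩
    funext i
    have key : (∃ j : Fin n, F.toList[(j : ℕ)]? = some i) ↔ x i ≠ 0 := by
      have : x i ≠ 0 ↔ i ∈ F.toList := by simp [hF]
      rw [this, List.mem_iff_getElem?]
      constructor
      · rintro ⟨j, hj⟩; exact ⟨j, hj⟩
      · rintro ⟨j, hj⟩
        have : j < F.toList.length := (List.getElem?_eq_some_iff.1 hj).1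
        exact ⟨⟨j, this.trans_le hlen⟩, hj⟩
    simp only [f, key]
    have h2 : ∀ z : ZMod 2, (if z ≠ 0 then (1 : ZMod 2) else 0) = z := by decide
    exact h2 (x i)
  calc _ ≤ (Set.range f).ncard := Set.ncard_le_ncard hsub (Set.toFinite _)
    _ ≤ Nat.card (Fin n → Option ι) := by
      rw [← Set.image_univ, ← Set.ncard_univ]
      exact Set.ncard_image_le (Set.toFinite _)
    _ = _ := by simp

section Combination

variable {A B : Type*} [Fintype B]

/-- The linear combination of the columns of `X` with coefficients `u`. -/
def colComb (X : A × B → ZMod 2) : (B → ZMod 2) →ₗ[ZMod 2] (A → ZMod 2) :=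
  Matrix.mulVecLin (Matrix.of fun a b => X (a, b))

lemma colComb_apply (X : A × B → ZMod 2) (u : B → ZMod 2) (a : A) :
    colComb X u a = ∑ b, X (a, b) * u b := rfl

/-- If `X` lies in the dual tensor code of `CA` and `ker H`, every row of `H` combines the columns
of `X` to a word of `CA`. -/
lemma colComb_mem_of_mem_dualTensor {R : Type*} {CA : Submodule (ZMod 2) (A → ZMod 2)}
    {H : Matrix R B (ZMod 2)} {X : A × B → ZMod 2}
    (hX : X ∈ dualTensor CA (LinearMap.ker H.mulVecLin)) (i : R) : colComb X (H i) ∈ CA := by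
  obtain ⟨Y, hY, Z, hZ, rfl⟩ := Submodule.mem_sup.1 hX
  have h : colComb (Y + Z) (H i) = ∑ b, H i b • (fun a => Y (a, b)) := by
    funext a
    have hz : ∑ b, H i b * Z (a, b) = 0 := congrFun (LinearMap.mem_ker.1 (hZ a)) i
    simp only [colComb_apply, Pi.add_apply, Finset.sum_apply, Pi.smul_apply, smul_eq_mul, add_mul,
      Finset.sum_add_distrib]
    simp only [mul_comm] at hz ⊢
    rw [hz, add_zero]
  rw [h]
  exact CA.sum_mem fun b _ => CA.smul_mem _ (hY b)

/-- A subspace meeting the words supported on `S` trivially has density at most `2 ^ (-|S|)`. -/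
lemma ncard_mul_two_pow_le (W : Submodule (ZMod 2) (B → ZMod 2)) (S : Finset B)
    (hS : ∀ u ∈ W, (∀ b ∉ S, u b = 0) → u = 0) :
    (W : Set (B → ZMod 2)).ncard * 2 ^ S.card ≤ 2 ^ Fintype.card B := by
  classical
  let ext : (S → ZMod 2) → (B → ZMod 2) := fun v b => if h : b ∈ S then v ⟨b, h⟩ else 0
  let f : W × (S → ZMod 2) → (B → ZMod 2) := fun p => p.1 + ext p.2
  have hf : Function.Injective f := by
    rintro ⟨w, v⟩ ⟨w', v'⟩ h
    have hb : ∀ b, (w : B → ZMod 2) b + ext v b = (w' : B → ZMod 2) b + ext v' b :=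
      fun b => congrFun h b
    have hw : (w : B → ZMod 2) - w' = 0 := by
      refine hS _ (W.sub_mem w.2 w'.2) fun b hbS => ?_
      have := hb b
      simp only [ext, hbS, dif_neg, not_false_eq_true, add_zero] at this
      simp [this]
    have hw' : w = w' := Subtype.ext (sub_eq_zero.1 hw)
    subst hw'
    congr 1
    funext b
    simpa [ext] using hb b
  have := Nat.card_le_card_of_injective f hf
  rw [Nat.card_prod] at this
  simpa [← Nat.card_coe_set_eq] using this

/-- Greedy choice of independent columns of weight at most `s`. -/
lemma exists_independent_columns [Fintype A] (X : A × B → ZMod 2) (s : ℝ) (hs : 0 ≤ s) (k : ℕ)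
    (hrow : k * s < {a | ∃ b, (wt fun a => X (a, b)) ≤ s ∧ X (a, b) ≠ 0}.ncard) (j : ℕ)
    (hj : j ≤ k) :
    ∃ S : Finset B, S.card = j ∧ (∀ b ∈ S, (wt fun a => X (a, b)) ≤ s) ∧
      ∀ u : B → ZMod 2, (∀ b ∉ S, u b = 0) → colComb X u = 0 → u = 0 := by
  classical
  induction j with
  | zero => exact ⟨∅, rfl, by simp, fun u hu _ => funext fun b => hu b (by simp)⟩
  | succ j ih =>
    obtain ⟨S, hcard, hlight, hind⟩ := ih (by lia)
    let U : Finset A := S.biUnion fun b => {a | X (a, b) ≠ 0}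
    have hU : (U.card : ℝ) ≤ k * s := by
      calc (U.card : ℝ) ≤ ((∑ b ∈ S, wt fun a => X (a, b) : ℕ) : ℝ) := by
            simp only [wt_eq_card]
            exact_mod_cast Finset.card_biUnion_le
        _ ≤ ∑ b ∈ S, s := by push_cast; exact Finset.sum_le_sum hlight
        _ ≤ k * s := by
            rw [Finset.sum_const, nsmul_eq_mul, hcard]
            gcongr
            lia
    obtain ⟨a, ⟨b, hb, hab⟩, haU⟩ : ∃ a ∈ {a | ∃ b, (wt fun a => X (a, b)) ≤ s ∧ X (a, b) ≠ 0},
        a ∉ (U : Set A) := by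
      refine Set.exists_mem_notMem_of_ncard_lt_ncard ?_ (Set.toFinite _)
      rw [Set.ncard_coe_finset]
      exact_mod_cast hU.trans_lt hrow
    have haS : ∀ b' ∈ S, X (a, b') = 0 := by
      simpa [U] using haU
    have hbS : b ∉ S := fun h => hab (haS b h)
    refine ⟨insert b S, by rw [Finset.card_insert_of_notMem hbS, hcard], ?_, ?_⟩
    · simpa [Finset.forall_mem_insert] using ⟨hb, hlight⟩
    · intro u hu h0
      refine hind u (fun b' hb' => ?_) h0
      by_cases hbb : b' = b
      · subst hbb
        have h := congrFun h0 a
        rw [colComb_apply, Finset.sum_eq_single b'] at h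
        · exact (mul_eq_zero.1 h).resolve_left hab
        · intro c _ hc
          by_cases hcS : c ∈ S
          · rw [haS c hcS, zero_mul]
          · rw [hu c (by simp [hc, hcS]), mul_zero]
        · simp
      · exact hu b' (by simp [hbb, hb'])

/-- A combination of columns supported on `S` has weight at most the total weight of the columns
in `S`. -/
lemma wt_colComb_le [Fintype A] (X : A × B → ZMod 2) (S : Finset B) (u : B → ZMod 2)
    (hu : ∀ b ∉ S, u b = 0) : wt (colComb X u) ≤ ∑ b ∈ S, wt fun a => X (a, b) := by
  classical
  simp only [wt_eq_card]
  refine (Finset.card_le_card fun a ha => ?_).trans Finset.card_biUnion_le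
  by_contra hna
  refine (Finset.mem_filter.1 ha).2 ?_
  rw [colComb_apply]
  refine Finset.sum_eq_zero fun b _ => ?_
  by_cases hb : b ∈ S
  · have : X (a, b) = 0 := by
      simp only [Finset.mem_biUnion, Finset.mem_filter_univ, not_exists, not_and, not_not] at hna
      exact hna b hb
    rw [this, zero_mul]
  · rw [hu b hb, mul_zero]

/-- The columns of weight more than `s` number at most `wt X / s`. -/
lemma ncard_heavy_columns_mul_le [Fintype A] (X : A × B → ZMod 2) (s : ℝ) :
    ({b | ¬ ((wt fun a => X (a, b)) ≤ s)}.ncard : ℝ) * s ≤ wt X := by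
  classical
  have hsum : wt X = ∑ b, wt fun a => X (a, b) := by
    simp only [wt_eq_card, Finset.card_filter]
    rw [Fintype.sum_prod_type_right]
  have hfin : {b | ¬ ((wt fun a => X (a, b)) ≤ s)}
      = ((Finset.univ.filter fun b => ¬ ((wt fun a => X (a, b)) ≤ s) : Finset B) : Set B) := by
    simp
  rw [hfin, Set.ncard_coe_finset, ← nsmul_eq_mul, ← Finset.sum_const, hsum]
  push_cast
  refine (Finset.sum_le_sum fun b hb => ?_).trans
    (Finset.sum_le_sum_of_subset_of_nonneg (Finset.subset_univ _) fun _ _ _ => Nat.cast_nonneg _)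
  exact (not_le.1 (Finset.mem_filter.1 hb).2).le

/-- If the light columns of `X` meet many rows, few matrices `H` have `X` in the dual tensor code
of `CA` and `ker H`. -/
lemma ncard_mem_dualTensor_mul_le [Fintype A] {r : ℕ} (CA : Submodule (ZMod 2) (A → ZMod 2))
    (X : A × B → ZMod 2) (s : ℝ) (hs : 0 ≤ s) (k : ℕ)
    (hrow : k * s < {a | ∃ b, (wt fun a => X (a, b)) ≤ s ∧ X (a, b) ≠ 0}.ncard)
    (hdist : k * s < minDist CA) :
    {H : Matrix (Fin r) B (ZMod 2) |
      X ∈ dualTensor CA (LinearMap.ker H.mulVecLin)}.ncard * 2 ^ (k * r)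
        ≤ 2 ^ (r * Fintype.card B) := by
  classical
  obtain ⟨S, hcard, hlight, hind⟩ := exists_independent_columns X s hs k hrow k le_rfl
  let W := CA.comap (colComb X)
  have hW := ncard_mul_two_pow_le W S fun u huW hu => by
    refine hind u hu (by_contra fun hne => ?_)
    have h1 : (minDist CA : ℝ) ≤ wt (colComb X u) := by exact_mod_cast minDist_le_wt (C := CA) huW hne
    have h2 : (wt (colComb X u) : ℝ) ≤ ∑ b ∈ S, s :=
      calc (wt (colComb X u) : ℝ) ≤ ((∑ b ∈ S, wt fun a => X (a, b) : ℕ) : ℝ) := by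
            exact_mod_cast wt_colComb_le X S u hu
        _ ≤ ∑ b ∈ S, s := by push_cast; exact Finset.sum_le_sum hlight
    rw [Finset.sum_const, nsmul_eq_mul, hcard] at h2
    linarith
  have hle : {H : Matrix (Fin r) B (ZMod 2) |
      X ∈ dualTensor CA (LinearMap.ker H.mulVecLin)}.ncard
        ≤ (W : Set (B → ZMod 2)).ncard ^ r := by
    let f : {H : Matrix (Fin r) B (ZMod 2) // X ∈ dualTensor CA (LinearMap.ker H.mulVecLin)} →
        (Fin r → W) := fun H i => ⟨H.1 i, colComb_mem_of_mem_dualTensor H.2 i⟩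
    have hf : Function.Injective f := fun H H' h =>
      Subtype.ext (funext fun i => congrArg Subtype.val (congrFun h i))
    have := Nat.card_le_card_of_injective f hf
    rw [Nat.card_fun, Nat.card_fin] at this
    exact this
  rw [hcard] at hW
  calc _ ≤ (W : Set (B → ZMod 2)).ncard ^ r * 2 ^ (k * r) := Nat.mul_le_mul_right _ hle
    _ = ((W : Set (B → ZMod 2)).ncard * 2 ^ k) ^ r := by rw [mul_pow, pow_mul]
    _ ≤ (2 ^ Fintype.card B) ^ r := Nat.pow_le_pow_left hW r
    _ = _ := by rw [← pow_mul, mul_comm]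

end Combination

/-- Union bound: if each of the events `E x`, `x ∈ T`, has probability at most `p`, then
all of them fail with probability at least `1 - |T| p`. -/
lemma one_sub_le_unifProb {Ω ι : Type*} [Fintype Ω] [Nonempty Ω] [Finite ι] (T : Set ι)
    (E : ι → Set Ω) (p : ℝ)
    (hE : ∀ x ∈ T, ((E x).ncard : ℝ) ≤ p * Fintype.card Ω) (G : Set Ω)
    (hG : ∀ ω, (∀ x ∈ T, ω ∉ E x) → ω ∈ G) : 1 - T.ncard * p ≤ unifProb G := by
  classical
  have hΩ : (0 : ℝ) < Fintype.card Ω := by exact_mod_cast Fintype.card_pos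
  have hT : T.Finite := T.toFinite
  have hsub : Gᶜ ⊆ ⋃ x ∈ hT.toFinset, E x := by
    intro ω hω
    by_contra hn
    refine hω (hG ω fun x hx hxE => hn ?_)
    simp only [Set.mem_iUnion]
    exact ⟨x, hT.mem_toFinset.2 hx, hxE⟩
  have hbad : (Gᶜ.ncard : ℝ) ≤ T.ncard * (p * Fintype.card Ω) := by
    calc (Gᶜ.ncard : ℝ) ≤ ((∑ x ∈ hT.toFinset, (E x).ncard : ℕ) : ℝ) := by
          exact_mod_cast (Set.ncard_le_ncard hsub (Set.toFinite _)).trans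
            (Finset.set_ncard_biUnion_le _ _)
      _ ≤ ∑ x ∈ hT.toFinset, p * Fintype.card Ω := by
          push_cast
          exact Finset.sum_le_sum fun x hx => hE x (hT.mem_toFinset.1 hx)
      _ = _ := by
          rw [Finset.sum_const, nsmul_eq_mul, Set.ncard_eq_toFinset_card T hT]
  have hadd : (G.ncard : ℝ) + Gᶜ.ncard = Fintype.card Ω := by
    rw [← Nat.card_eq_fintype_card]
    exact_mod_cast Set.ncard_add_ncard_compl G
  rw [unifProb, le_div_iff₀ hΩ]
  nlinarith

/-- The number of square binary matrices of weight at most `δ / 2 * n ^ (3 / 2) / log n`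
is at most `2 ^ (2 * n ^ (3 / 2))`. -/
lemma ncard_light_matrices_le {δ : ℝ} (hδ0 : 0 < δ) (hδ1 : δ < 1) {n : ℕ} (hn : 2 ≤ n) :
    ({X : Fin n × Fin n → ZMod 2 |
      (wt X : ℝ) ≤ δ / 2 * (n : ℝ) ^ ((3 : ℝ) / 2) / Real.logb 2 n}.ncard : ℝ)
        ≤ (2 : ℝ) ^ (2 * (n : ℝ) ^ ((3 : ℝ) / 2)) := by
  set w : ℝ := δ / 2 * (n : ℝ) ^ ((3 : ℝ) / 2) / Real.logb 2 n with hw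
  have hn' : (2 : ℝ) ≤ n := by exact_mod_cast hn
  have hlog : 0 < Real.logb 2 n := Real.logb_pos (by norm_num) (by linarith)
  have hP : 0 < (n : ℝ) ^ ((3 : ℝ) / 2) := Real.rpow_pos_of_pos (by linarith) _
  have hw0 : 0 ≤ w := by positivity
  have hset : {X : Fin n × Fin n → ZMod 2 | (wt X : ℝ) ≤ w} = {X | wt X ≤ ⌊w⌋₊} := by
    ext X; simp [Nat.le_floor_iff hw0]
  have hcube : ((Fintype.card (Fin n × Fin n) + 1 : ℕ) : ℝ) ≤ (2 : ℝ) ^ (3 * Real.logb 2 n) := by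
    rw [mul_comm, Real.rpow_mul (by norm_num), Real.rpow_logb (by norm_num) (by norm_num)
      (by linarith)]
    simp only [Fintype.card_prod, Fintype.card_fin]
    norm_cast
    nlinarith
  rw [hset]
  calc ({X : Fin n × Fin n → ZMod 2 | wt X ≤ ⌊w⌋₊}.ncard : ℝ)
      ≤ ((Fintype.card (Fin n × Fin n) + 1 : ℕ) : ℝ) ^ ⌊w⌋₊ := by exact_mod_cast ncard_wt_le _
    _ ≤ ((2 : ℝ) ^ (3 * Real.logb 2 n)) ^ ⌊w⌋₊ := by gcongr
    _ = (2 : ℝ) ^ (3 * Real.logb 2 n * ⌊w⌋₊) := by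
        rw [← Real.rpow_natCast, ← Real.rpow_mul (by norm_num)]
    _ ≤ _ := by
        refine Real.rpow_le_rpow_of_exponent_le (by norm_num) ?_
        calc 3 * Real.logb 2 n * ⌊w⌋₊ ≤ 3 * Real.logb 2 n * w := by
              gcongr; exact Nat.floor_le hw0
          _ = 3 * (δ / 2 * (n : ℝ) ^ ((3 : ℝ) / 2)) := by rw [hw]; field_simp
          _ ≤ _ := by nlinarith

/-- Theorem 11: with high probability over the random row code,
every light codeword of the dual tensor code is supported on few rows and columns. -/
theorem random_dual_tensor_support_concentration
    (ρ δ : ℝ) (hρ0 : 0 < ρ) (hρ1 : ρ < 1) (hδ0 : 0 < δ) (hδ1 : δ < 1)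
    (hδhalf : δ < 1/2)
    (hent : -δ * Real.logb 2 δ - (1 - δ) * Real.logb 2 (1 - δ) < 1 - ρ) :
    ∃ c : ℝ, 0 < c ∧ ∃ Δ₀ : ℕ, ∀ Δ : ℕ, Δ₀ ≤ Δ →
      ∀ CA : Submodule (ZMod 2) (Fin Δ → ZMod 2), δ * Δ ≤ (minDist CA : ℝ) →
      ∀ r : ℕ, (1 - ρ) * Δ ≤ (r : ℝ) →
        1 - (2 : ℝ) ^ (-(c * (Δ : ℝ) ^ ((3 : ℝ)/2))) ≤
          unifProb {H : Matrix (Fin r) (Fin Δ) (ZMod 2) |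
            ∀ X : Fin Δ × Fin Δ → ZMod 2,
              (wt X : ℝ) ≤ δ/2 * (Δ : ℝ) ^ ((3 : ℝ)/2) / Real.logb 2 Δ →
              ((∃ (A' B' : Set (Fin Δ)),
                  (A'.ncard : ℝ) ≤ δ * Δ / 2 ∧ (B'.ncard : ℝ) ≤ δ * Δ / 2 ∧
                  ∀ a b, a ∉ A' → b ∉ B' → X (a, b) = 0) ∨
                X ∉ dualTensor CA (LinearMap.ker H.mulVecLin))} := by
  have hK1 : 1 ≤ 3 / (1 - ρ) := by rw [le_div_iff₀ (by linarith)]; linarith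
  have hKρ : 3 / (1 - ρ) * (1 - ρ) = 3 := div_mul_cancel₀ _ (by linarith)
  set K : ℝ := 3 / (1 - ρ)
  refine ⟨1, one_pos, max 2 ⌈(2 : ℝ) ^ (4 * K / δ)⌉₊, fun n hn CA hCA r hr => ?_⟩
  have hn2 : 2 ≤ n := (le_max_left _ _).trans hn
  have hn' : (2 : ℝ) ≤ n := by exact_mod_cast hn2
  have hn0 : (0 : ℝ) < n := by linarith
  have hlogK : 4 * K / δ ≤ Real.logb 2 n := by
    rw [Real.le_logb_iff_rpow_le (by norm_num) hn0]
    exact (Nat.le_ceil _).trans (by exact_mod_cast (le_max_right _ _).trans hn)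
  have hlog : 0 < Real.logb 2 n := lt_of_lt_of_le (by positivity) hlogK
  set q : ℝ := √n with hq
  have hqq : q * q = n := Real.mul_self_sqrt hn0.le
  have hq1 : 1 ≤ q := Real.one_le_sqrt.2 (by linarith)
  have hP : (n : ℝ) ^ ((3 : ℝ) / 2) = n * q := by
    rw [show (3 : ℝ) / 2 = 1 + 1 / 2 by norm_num, Real.rpow_add hn0, Real.rpow_one,
      ← Real.sqrt_eq_rpow]
  set k : ℕ := ⌈K * q⌉₊ with hk
  have hkl : K * q ≤ k := Nat.le_ceil _
  have hku : (k : ℝ) ≤ 2 * K * q := by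
    have : (k : ℝ) < K * q + 1 := Nat.ceil_lt_add_one (by positivity)
    nlinarith
  have hk0 : (0 : ℝ) < k := lt_of_lt_of_le (by positivity) hkl
  set s : ℝ := δ * n / (2 * k) with hs
  have hs0 : 0 < s := by positivity
  have hks : k * s = δ * n / 2 := by rw [hs]; field_simp
  have hexp : 3 * (n * q) ≤ (k * r : ℕ) := by
    push_cast
    calc 3 * (n * q) = (K * q) * ((1 - ρ) * n) := by linear_combination -(n * q) * hKρ
      _ ≤ k * r := mul_le_mul hkl hr (mul_nonneg (by linarith) hn0.le) hk0.le
  let T : Set (Fin n × Fin n → ZMod 2) :=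
    {X | (wt X : ℝ) ≤ δ / 2 * (n : ℝ) ^ ((3 : ℝ) / 2) / Real.logb 2 n ∧
      ¬ ∃ (A' B' : Set (Fin n)), (A'.ncard : ℝ) ≤ δ * n / 2 ∧ (B'.ncard : ℝ) ≤ δ * n / 2 ∧
        ∀ a b, a ∉ A' → b ∉ B' → X (a, b) = 0}
  have hTcard : (T.ncard : ℝ) ≤ (2 : ℝ) ^ (2 * (n * q)) := by
    rw [← hP]
    refine le_trans ?_ (ncard_light_matrices_le hδ0 hδ1 hn2)
    exact Nat.cast_le.2 (Set.ncard_le_ncard (fun X hX => hX.1) (Set.toFinite _))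
  have hE : ∀ X ∈ T, (({H : Matrix (Fin r) (Fin n) (ZMod 2) |
      X ∈ dualTensor CA (LinearMap.ker H.mulVecLin)}.ncard : ℕ) : ℝ)
        ≤ (2 : ℝ) ^ (-(3 * (n * q))) * Fintype.card (Matrix (Fin r) (Fin n) (ZMod 2)) := by
    intro X hX
    have hheavy : ({b | ¬ ((wt fun a => X (a, b)) ≤ s)}.ncard : ℝ) ≤ δ * n / 2 := by
      have h1 := (ncard_heavy_columns_mul_le X s).trans hX.1
      rw [hP] at h1
      rw [← le_div_iff₀ hs0] at h1
      refine h1.trans ?_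
      have h2 : δ / 2 * (n * q) / Real.logb 2 n / s = q * k / Real.logb 2 n := by
        rw [hs]; field_simp
      rw [h2, div_le_iff₀ hlog]
      rw [div_le_iff₀ hδ0] at hlogK
      calc q * k ≤ q * (2 * K * q) := by gcongr
        _ = n / 2 * (4 * K) := by rw [← hqq]; ring
        _ ≤ n / 2 * (Real.logb 2 n * δ) := by gcongr
        _ = _ := by ring
    have hrow : k * s < {a | ∃ b, (wt fun a => X (a, b)) ≤ s ∧ X (a, b) ≠ 0}.ncard := by
      by_contra hcon
      rw [hks, not_lt] at hcon
      refine hX.2 ⟨_, _, hcon, hheavy, fun a b ha hb => ?_⟩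
      by_contra hab
      exact ha ⟨b, not_not.1 hb, hab⟩
    have hdist : k * s < minDist CA := by
      rw [hks]
      have : 0 < δ * n := by positivity
      linarith
    have hcount := ncard_mem_dualTensor_mul_le (r := r) CA X s hs0.le k hrow hdist
    have hcardΩ : Fintype.card (Matrix (Fin r) (Fin n) (ZMod 2))
        = 2 ^ (r * Fintype.card (Fin n)) := by
      rw [← Nat.card_eq_fintype_card, show Nat.card (Matrix (Fin r) (Fin n) (ZMod 2))
        = Nat.card (Fin r → Fin n → ZMod 2) from rfl]
      simp [← pow_mul, mul_comm]
    rw [← hcardΩ] at hcount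
    rw [Real.rpow_neg (by norm_num), inv_mul_eq_div, le_div_iff₀ (by positivity)]
    calc _ ≤ _ * (2 : ℝ) ^ (k * r) := by
          refine mul_le_mul_of_nonneg_left ?_ (Nat.cast_nonneg _)
          rw [← Real.rpow_natCast]
          exact Real.rpow_le_rpow_of_exponent_le (by norm_num) hexp
      _ ≤ _ := by exact_mod_cast hcount
  refine le_trans ?_ (one_sub_le_unifProb T _ _ hE _ fun H hH X hw =>
    or_iff_not_imp_left.2 fun hX => hH X ⟨hw, hX⟩)
  rw [hP]
  have : (T.ncard : ℝ) * (2 : ℝ) ^ (-(3 * (n * q))) ≤ (2 : ℝ) ^ (-(1 * (n * q))) :=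
    calc _ ≤ (2 : ℝ) ^ (2 * (n * q)) * (2 : ℝ) ^ (-(3 * (n * q))) := by gcongr
      _ = _ := by rw [← Real.rpow_add (by norm_num)]; congr 1; ring
  linarith
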